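/- arXiv:1505.00995 — 5 statements merged into one kernel-verified Lean document; each statement's English description precedes it below -/
import Mathlib

section
/- Let n ∈ ℝ³ be a unit vector and let A, B ∈ ℝ^{3×3} satisfy A·(𝟙 − n⊗n) = B·(𝟙 − n⊗n) (i.e. the two matrices have the same action on every vector orthogonal to n). Then the tangential parts of their axial vectors coincide if and only if the tangential parts of their actions on n coincide: (𝟙 − n⊗n)·axl(skw A) = (𝟙 − n⊗n)·axl(skw B) ⟺ (𝟙 − n⊗n)·A·n = (𝟙 − n⊗n)·B·n. (This is the pointwise content of the paper's Lemma on the equivalence of the geometric boundary conditions: for two displacement fields agreeing on a surface with unit normal n, prescribing the tangential part of curl u is equivalent to prescribing the tangential part of ∇u·n.) -/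
noncomputable section

open scoped BigOperators

/-- Vectors in ℝ³. -/
abbrev V3 : Type := Fin 3 → ℝ

/-- 3×3 real matrices. -/
abbrev M3 : Type := Matrix (Fin 3) (Fin 3) ℝ

/-- The Levi-Civita symbol on `Fin 3`. -/
def eps (i j k : Fin 3) : ℝ :=
  if (i = 0 ∧ j = 1 ∧ k = 2) ∨ (i = 1 ∧ j = 2 ∧ k = 0) ∨ (i = 2 ∧ j = 0 ∧ k = 1) then 1
  else if (i = 0 ∧ j = 2 ∧ k = 1) ∨ (i = 2 ∧ j = 1 ∧ k = 0) ∨ (i = 1 ∧ j = 0 ∧ k = 2) then -1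
  else 0

/-- Euclidean inner product on ℝ³. -/
def dot (a b : V3) : ℝ := ∑ i, a i * b i

/-- Cross product on ℝ³: `(a × b)_i = Σ_{j,k} ε_{ijk} a_j b_k`. -/
def cross (a b : V3) : V3 := fun i => ∑ j, ∑ k, eps i j k * a j * b k

/-- Dyadic product `(a ⊗ b)_{ij} = a_i b_j`. -/
def tensor (a b : V3) : M3 := Matrix.of fun i j => a i * b j

/-- Symmetric part `sym X = (X + Xᵀ)/2`. -/
def symPart (X : M3) : M3 := (1 / 2 : ℝ) • (X + X.transpose)

/-- Skew-symmetric part `skw X = (X − Xᵀ)/2`. -/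
def skwPart (X : M3) : M3 := (1 / 2 : ℝ) • (X - X.transpose)

/-- Deviatoric part `dev X = X − (tr X / 3)·𝟙`. -/
def devPart (X : M3) : M3 := X - ((Matrix.trace X) / 3) • (1 : M3)

/-- Axial vector: `axl(X)_k = −(1/2) Σ_{i,j} ε_{ijk} X_{ij}`. -/
def axl (X : M3) : V3 := fun k => -(1 / 2 : ℝ) * ∑ i, ∑ j, eps i j k * X i j

/-- `anti(v)_{ij} = −Σ_k ε_{ijk} v_k`, so that `anti(v)·w = v × w`. -/
def antiV (v : V3) : M3 := Matrix.of fun i j => -(∑ k, eps i j k * v k)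

/-- Squared Frobenius norm `‖X‖² = Σ_{ij} X_{ij}²`. -/
def normSq (X : M3) : ℝ := ∑ i, ∑ j, (X i j) ^ 2

/-- `k`-th standard basis vector of ℝ³. -/
def ee (k : Fin 3) : V3 := Pi.single k 1

/-- Partial derivative `∂_k f` of a scalar field. -/
def pd (f : V3 → ℝ) (k : Fin 3) (x : V3) : ℝ := fderiv ℝ f x (ee k)

/-- Gradient of a scalar field. -/
def grad (f : V3 → ℝ) (x : V3) : V3 := fun k => pd f k x

/-- Partial derivative `∂_k u_i` of a vector field. -/
def pdV (u : V3 → V3) (i k : Fin 3) (x : V3) : ℝ := pd (fun y => u y i) k x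

/-- Gradient matrix `(∇u)_{ij} = ∂_j u_i`. -/
def gradV (u : V3 → V3) (x : V3) : M3 := Matrix.of fun i j => pdV u i j x

/-- Divergence `div u = Σ_p ∂_p u_p`. -/
def divV (u : V3 → V3) (x : V3) : ℝ := ∑ p, pdV u p p x

/-- Curl: `(curl u)_i = Σ_{j,k} ε_{ijk} ∂_j u_k`. -/
def curl (u : V3 → V3) (x : V3) : V3 := fun i => ∑ j, ∑ k, eps i j k * pdV u k j x

/-- Second partial derivative `∂_k ∂_j u_i` of a vector field. -/
def pd2V (u : V3 → V3) (i j k : Fin 3) (x : V3) : ℝ := pd (fun y => pdV u i j y) k x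

/-- Scalar Laplacian `Δf = Σ_m ∂_m ∂_m f`. -/
def lap (f : V3 → ℝ) (x : V3) : ℝ := ∑ m, pd (fun y => pd f m y) m x

lemma tensor_mulVec (a b v : V3) : (tensor a b).mulVec v = dot b v • a := by
  ext i
  simp only [tensor, dot, Matrix.mulVec, dotProduct, Matrix.of_apply, Pi.smul_apply, smul_eq_mul,
    Finset.sum_mul]
  exact Finset.sum_congr rfl fun j _ => by ring

lemma mul_tensor (X : M3) (a b : V3) : X * tensor a b = tensor (X.mulVec a) b := by
  ext i j
  simp only [tensor, Matrix.mul_apply, Matrix.mulVec, dotProduct, Matrix.of_apply, Finset.sum_mul]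
  exact Finset.sum_congr rfl fun k _ => by ring

lemma axl_skwPart_sub (A B : M3) :
    axl (skwPart (A - B)) = axl (skwPart A) - axl (skwPart B) := by
  ext k
  simp only [axl, skwPart, Matrix.transpose_sub, Matrix.smul_apply, Matrix.sub_apply,
    Pi.sub_apply, ← mul_sub, ← Finset.sum_sub_distrib, smul_eq_mul]
  congr 1
  exact Finset.sum_congr rfl fun i _ => Finset.sum_congr rfl fun j _ => by ring

lemma axl_skwPart_tensor (a b : V3) : axl (skwPart (tensor a b)) = (1 / 2 : ℝ) • cross b a := by
  ext k
  fin_cases k <;>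
    simp [axl, skwPart, tensor, cross, eps, Fin.sum_univ_three] <;> ring

lemma dot_cross_same (a b : V3) : dot a (cross a b) = 0 := by
  simp [dot, cross, eps, Fin.sum_univ_three]
  ring

lemma cross_cross_self (a b : V3) : cross a (cross a b) = dot a b • a - dot a a • b := by
  ext k
  fin_cases k <;> simp [dot, cross, eps, Fin.sum_univ_three] <;> ring

lemma cross_smul_self (r : ℝ) (a : V3) : cross a (r • a) = 0 := by
  ext k
  fin_cases k <;> simp [cross, eps, Fin.sum_univ_three] <;> ring

lemma cross_zero (a : V3) : cross a 0 = 0 := by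
  ext k
  simp [cross]

/-- For a unit vector `n`, `n × c` vanishes exactly when the tangential part of `c` does. -/
lemma cross_eq_zero_iff_tangential {n : V3} (hn : dot n n = 1) (c : V3) :
    cross n c = 0 ↔ ((1 : M3) - tensor n n).mulVec c = 0 := by
  rw [Matrix.sub_mulVec, Matrix.one_mulVec, tensor_mulVec, sub_eq_zero]
  constructor
  · intro hc
    have key := cross_cross_self n c
    rw [hc, cross_zero, hn, one_smul] at key
    exact (sub_eq_zero.mp key.symm).symm
  · intro hc
    rw [hc, cross_smul_self]

/-- Equivalence of the two tangential geometric boundary data (pointwise content of the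
Lemma on equivalence of geometric boundary conditions). -/
theorem statement0 (n : V3) (hn : dot n n = 1) (A B : M3)
    (h : A * ((1 : M3) - tensor n n) = B * ((1 : M3) - tensor n n)) :
    ((1 : M3) - tensor n n).mulVec (axl (skwPart A)) =
        ((1 : M3) - tensor n n).mulVec (axl (skwPart B)) ↔
      ((1 : M3) - tensor n n).mulVec (A.mulVec n) =
        ((1 : M3) - tensor n n).mulVec (B.mulVec n) := by
  obtain ⟨c, hc⟩ : ∃ c, (A - B).mulVec n = c := ⟨_, rfl⟩
  have hX : A - B = tensor c n := by
    rw [← sub_eq_zero, ← Matrix.sub_mul, mul_sub, mul_one, mul_tensor, hc] at h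
    exact sub_eq_zero.mp h
  rw [← sub_eq_zero, ← Matrix.mulVec_sub, ← axl_skwPart_sub, hX, axl_skwPart_tensor,
    Matrix.mulVec_smul, Matrix.sub_mulVec, Matrix.one_mulVec, tensor_mulVec, dot_cross_same,
    zero_smul, sub_zero, smul_eq_zero_iff_right (by norm_num), cross_eq_zero_iff_tangential hn,
    ← hc, Matrix.sub_mulVec A B, Matrix.mulVec_sub, sub_eq_zero]
end
end

section
/- Let m : ℝ³ → ℝ^{3×3} be of class C¹, let F : ℝ³ → ℝ be of class C², and let x₀ ∈ ℝ³ with ∇F(x₀) ≠ 0. On the open set where ∇F ≠ 0 define the unit normal field n = ∇F/‖∇F‖ and the tangential projector T = 𝟙 − n⊗n. Then at x₀ the following identity holds: (1/2)·∇[anti(m·n)·T]:T = (1/2)·n × ∇(⟨n, (sym m)·n⟩) + (1/2)·∇[anti(T·m·n)·T]:T, where for a matrix field K the vector ∇[K]:T has components (∇[K]:T)_i = Σ_{j,k} ∂_k K_{ij} · T_{jk}, and ∇ψ denotes the gradient of a scalar field ψ. -/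
noncomputable section

open scoped BigOperators

/-- Unit normal field `n = ∇F/‖∇F‖` of the level surface of `F`. -/
def unitNormal (F : V3 → ℝ) (x : V3) : V3 :=
  fun i => grad F x i / Real.sqrt (dot (grad F x) (grad F x))

/-- Tangential projector `T = 𝟙 − n ⊗ n`. -/
def tangProj (F : V3 → ℝ) (x : V3) : M3 :=
  (1 : M3) - tensor (unitNormal F x) (unitNormal F x)

theorem pd_add {f g : V3 → ℝ} {x : V3} (hf : DifferentiableAt ℝ f x)
    (hg : DifferentiableAt ℝ g x) (k : Fin 3) :
    pd (fun y => f y + g y) k x = pd f k x + pd g k x := by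
  simp only [pd, fderiv_fun_add hf hg, add_apply]

theorem pd_mul {f g : V3 → ℝ} {x : V3} (hf : DifferentiableAt ℝ f x)
    (hg : DifferentiableAt ℝ g x) (k : Fin 3) :
    pd (fun y => f y * g y) k x = pd f k x * g x + f x * pd g k x := by
  simp only [pd, fderiv_fun_mul hf hg, add_apply, smul_apply, smul_eq_mul]
  ring

theorem pd_const (c : ℝ) (k : Fin 3) (x : V3) : pd (fun _ => c) k x = 0 := by
  simp [pd]

theorem pd_const_mul {f : V3 → ℝ} {x : V3} (hf : DifferentiableAt ℝ f x) (c : ℝ) (k : Fin 3) :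
    pd (fun y => c * f y) k x = c * pd f k x := by
  simpa [pd_const] using pd_mul (differentiableAt_const c) hf k

theorem differentiableAt_pd {F : V3 → ℝ} (hF : ContDiff ℝ 2 F) (i : Fin 3) (x : V3) :
    DifferentiableAt ℝ (fun y => pd F i y) x := by
  have h : Differentiable ℝ (fderiv ℝ F) :=
    (hF.fderiv_right (m := 1) (by norm_num)).differentiable (by norm_num)
  unfold pd
  fun_prop

theorem pd_pd_comm {F : V3 → ℝ} (hF : ContDiff ℝ 2 F) (i j : Fin 3) (x : V3) :
    pd (fun y => pd F i y) j x = pd (fun y => pd F j y) i x := by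
  have h : Differentiable ℝ (fderiv ℝ F) :=
    (hF.fderiv_right (m := 1) (by norm_num)).differentiable (by norm_num)
  have key : ∀ a b, pd (fun y => pd F a y) b x = fderiv ℝ (fderiv ℝ F) x (ee b) (ee a) := by
    intro a b
    simp only [pd]
    rw [fderiv_clm_apply (h x) (differentiableAt_const _)]
    simp
  rw [key, key]
  exact (hF.contDiffAt.isSymmSndFDerivAt (by simp)).eq _ _

theorem dot_self_pos {v : V3} (hv : v ≠ 0) : 0 < dot v v := by
  obtain ⟨i, hi⟩ := Function.ne_iff.mp hv
  exact Finset.sum_pos' (fun j _ => mul_self_nonneg _) ⟨i, Finset.mem_univ _, mul_self_pos.mpr hi⟩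

theorem differentiableAt_inv_norm_grad {F : V3 → ℝ} {x : V3} (hF : ContDiff ℝ 2 F)
    (hx : grad F x ≠ 0) :
    DifferentiableAt ℝ (fun y => (Real.sqrt (dot (grad F y) (grad F y)))⁻¹) x := by
  have hg := fun i => differentiableAt_pd hF i x
  have hp := dot_self_pos hx
  refine DifferentiableAt.inv (DifferentiableAt.sqrt ?_ hp.ne') (Real.sqrt_pos.mpr hp).ne'
  simp only [dot, grad]
  fun_prop

theorem differentiableAt_unitNormal {F : V3 → ℝ} {x : V3} (hF : ContDiff ℝ 2 F)
    (hx : grad F x ≠ 0) (i : Fin 3) : DifferentiableAt ℝ (fun y => unitNormal F y i) x := by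
  simp only [unitNormal, div_eq_mul_inv]
  exact (differentiableAt_pd hF i x).mul (differentiableAt_inv_norm_grad hF hx)

theorem dot_unitNormal_self {F : V3 → ℝ} {x : V3} (hx : grad F x ≠ 0) :
    dot (unitNormal F x) (unitNormal F x) = 1 := by
  have hp := dot_self_pos hx
  have h : dot (unitNormal F x) (unitNormal F x) =
      dot (grad F x) (grad F x) / Real.sqrt (dot (grad F x) (grad F x)) ^ 2 := by
    simp only [dot, unitNormal, Finset.sum_div]
    exact Finset.sum_congr rfl fun i _ => by ring
  rw [h, Real.sq_sqrt hp.le, div_self hp.ne']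

/-- `⟨n, ∂ₖn⟩ = 0`, because `‖n‖ = 1` near a point where `∇F ≠ 0`. -/
theorem sum_unitNormal_mul_pd {F : V3 → ℝ} {x : V3} (hF : ContDiff ℝ 2 F)
    (hx : grad F x ≠ 0) (k : Fin 3) :
    ∑ l, unitNormal F x l * pd (fun y => unitNormal F y l) k x = 0 := by
  have hn := differentiableAt_unitNormal hF hx
  have hc : ContinuousAt (grad F) x :=
    continuousAt_pi.mpr fun i => (differentiableAt_pd hF i x).continuousAt
  have he : (fun y => dot (unitNormal F y) (unitNormal F y)) =ᶠ[nhds x] fun _ => 1 := by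
    filter_upwards [hc.eventually_ne hx] with y hy using dot_unitNormal_self hy
  have h0 : pd (fun y => dot (unitNormal F y) (unitNormal F y)) k x = 0 := by
    rw [pd, he.fderiv_eq]
    simp
  have hs : pd (fun y => dot (unitNormal F y) (unitNormal F y)) k x =
      2 * ∑ l, unitNormal F x l * pd (fun y => unitNormal F y l) k x := by
    simp only [dot, Fin.sum_univ_three]
    rw [pd_add (by fun_prop) (by fun_prop), pd_add (by fun_prop) (by fun_prop),
      pd_mul (hn 0) (hn 0), pd_mul (hn 1) (hn 1), pd_mul (hn 2) (hn 2)]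
    ring
  linarith

/-- `∇n = ‖∇F‖⁻¹ T ∇²F`. -/
theorem pd_unitNormal {F : V3 → ℝ} {x : V3} (hF : ContDiff ℝ 2 F)
    (hx : grad F x ≠ 0) (l k : Fin 3) :
    pd (fun y => unitNormal F y l) k x = (Real.sqrt (dot (grad F x) (grad F x)))⁻¹ *
      ∑ p, tangProj F x l p * pd (fun y => pd F p y) k x := by
  have hs := (Real.sqrt_pos.mpr (dot_self_pos hx)).ne'
  set s := Real.sqrt (dot (grad F x) (grad F x)) with hsdef
  set r := pd (fun y => (Real.sqrt (dot (grad F y) (grad F y)))⁻¹) k x with hr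
  have hd : ∀ a, pd (fun y => unitNormal F y a) k x =
      pd (fun y => pd F a y) k x * s⁻¹ + s * unitNormal F x a * r := by
    intro a
    have hg : s * unitNormal F x a = pd F a x := by
      simp only [unitNormal, ← hsdef, grad]
      field_simp
    rw [hg]
    simp only [unitNormal, div_eq_mul_inv]
    exact pd_mul (differentiableAt_pd hF a x) (differentiableAt_inv_norm_grad hF hx) k
  have h0 := sum_unitNormal_mul_pd hF hx k
  have h1 := dot_unitNormal_self hx
  simp only [hd, dot, Fin.sum_univ_three] at h0 h1
  rw [hd]
  have ht : ∑ p, tangProj F x l p * pd (fun y => pd F p y) k x =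
      pd (fun y => pd F l y) k x -
        unitNormal F x l * ∑ p, unitNormal F x p * pd (fun y => pd F p y) k x := by
    simp [tangProj, tensor, Matrix.one_apply, sub_mul, Finset.sum_sub_distrib, Finset.mul_sum,
      mul_assoc]
  rw [ht, Fin.sum_univ_three]
  linear_combination unitNormal F x l * h0 - s * r * unitNormal F x l * h1

/-- `∇n T` is symmetric, being `‖∇F‖⁻¹ T ∇²F T`. -/
theorem pd_unitNormal_mul_tangProj_symm {F : V3 → ℝ} {x : V3} (hF : ContDiff ℝ 2 F)
    (hx : grad F x ≠ 0) (l j : Fin 3) :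
    ∑ k, pd (fun y => unitNormal F y l) k x * tangProj F x j k =
      ∑ k, pd (fun y => unitNormal F y j) k x * tangProj F x l k := by
  simp only [pd_unitNormal hF hx, Finset.mul_sum, Finset.sum_mul]
  rw [Finset.sum_comm]
  refine Finset.sum_congr rfl fun k _ => Finset.sum_congr rfl fun p _ => ?_
  rw [pd_pd_comm hF k p x]
  ring

theorem sum_eps_mul_symm (S : Fin 3 → Fin 3 → ℝ) (hS : ∀ j l, S j l = S l j) (i : Fin 3) :
    ∑ j, ∑ l, eps i j l * S j l = 0 := by
  have h01 := hS 0 1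
  have h02 := hS 0 2
  have h12 := hS 1 2
  fin_cases i <;> simp [Fin.sum_univ_three, eps] <;> linarith

theorem antiV_mulVec_eq_cross (v w : V3) (i : Fin 3) :
    ∑ j, antiV v i j * w j = cross v w i := by
  fin_cases i <;> simp [Fin.sum_univ_three, antiV, cross, eps, add_comm]

/-- `anti(X n) T = anti(T X n) T + ⟨n, (sym X) n⟩ anti(n)`, where `T = 𝟙 − n ⊗ n`. -/
theorem antiV_mul_proj_split (X : M3) (n : V3) (i j : Fin 3) :
    (antiV (X.mulVec n) * ((1 : M3) - tensor n n)) i j =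
      (antiV (((1 : M3) - tensor n n).mulVec (X.mulVec n)) * ((1 : M3) - tensor n n)) i j +
        dot n ((symPart X).mulVec n) * antiV n i j := by
  fin_cases i <;> fin_cases j <;>
    simp [Fin.sum_univ_three, antiV, eps, Matrix.mul_apply, Matrix.mulVec, dotProduct,
      tensor, dot, symPart, Matrix.one_apply] <;> ring

theorem antiV_mul_tangProj (F : V3 → ℝ) (x : V3) :
    antiV (unitNormal F x) * tangProj F x = antiV (unitNormal F x) := by
  ext i j
  fin_cases i <;> fin_cases j <;>
    simp [Fin.sum_univ_three, antiV, eps, Matrix.mul_apply, tangProj, tensor,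
      Matrix.one_apply] <;> ring

theorem differentiableAt_antiV {u : V3 → V3} {x : V3}
    (hu : ∀ l, DifferentiableAt ℝ (fun y => u y l) x) (i j : Fin 3) :
    DifferentiableAt ℝ (fun y => antiV (u y) i j) x := by
  simp only [antiV, Matrix.of_apply]
  fun_prop

theorem pd_antiV {u : V3 → V3} {x : V3} (hu : ∀ l, DifferentiableAt ℝ (fun y => u y l) x)
    (i j k : Fin 3) :
    pd (fun y => antiV (u y) i j) k x = -∑ l, eps i j l * pd (fun y => u y l) k x := by
  have h : (fun y => antiV (u y) i j) =
      fun y => (-eps i j 0) * u y 0 + (-eps i j 1) * u y 1 + (-eps i j 2) * u y 2 := by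
    funext y
    simp only [antiV, Matrix.of_apply, Fin.sum_univ_three]
    ring
  rw [h, pd_add (by fun_prop) (by fun_prop), pd_add (by fun_prop) (by fun_prop),
    pd_const_mul (hu 0), pd_const_mul (hu 1), pd_const_mul (hu 2), Fin.sum_univ_three]
  ring

/-- `∇[anti(n)]:T = 0`. -/
theorem sum_pd_antiV_unitNormal {F : V3 → ℝ} {x : V3} (hF : ContDiff ℝ 2 F)
    (hx : grad F x ≠ 0) (i : Fin 3) :
    ∑ j, ∑ k, pd (fun y => antiV (unitNormal F y) i j) k x * tangProj F x j k = 0 := by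
  have h := sum_eps_mul_symm
    (fun j l => ∑ k, pd (fun y => unitNormal F y l) k x * tangProj F x j k)
    (fun j l => pd_unitNormal_mul_tangProj_symm hF hx l j) i
  simp only [pd_antiV (differentiableAt_unitNormal hF hx), neg_mul, Finset.sum_neg_distrib,
    neg_eq_zero]
  rw [← h]
  refine Finset.sum_congr rfl fun j _ => ?_
  simp only [Finset.sum_mul, Finset.mul_sum]
  rw [Finset.sum_comm]
  exact Finset.sum_congr rfl fun l _ => Finset.sum_congr rfl fun k _ => by ring

/-- `∇[ψ anti(n)]:T = n × ∇ψ`. -/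
theorem sum_pd_mul_antiV_unitNormal {F ψ : V3 → ℝ} {x : V3} (hF : ContDiff ℝ 2 F)
    (hx : grad F x ≠ 0) (hψ : DifferentiableAt ℝ ψ x) (i : Fin 3) :
    ∑ j, ∑ k, pd (fun y => ψ y * antiV (unitNormal F y) i j) k x * tangProj F x j k =
      cross (unitNormal F x) (grad ψ x) i := by
  have hA := differentiableAt_antiV (differentiableAt_unitNormal hF hx) i
  have h0 := sum_pd_antiV_unitNormal hF hx i
  have hsplit : ∑ j, ∑ k, pd (fun y => ψ y * antiV (unitNormal F y) i j) k x * tangProj F x j k =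
      (∑ j, ∑ k, pd ψ k x * antiV (unitNormal F x) i j * tangProj F x j k) + ψ x *
        ∑ j, ∑ k, pd (fun y => antiV (unitNormal F y) i j) k x * tangProj F x j k := by
    simp only [pd_mul hψ (hA _), Finset.mul_sum, ← Finset.sum_add_distrib]
    exact Finset.sum_congr rfl fun j _ => Finset.sum_congr rfl fun k _ => by ring
  rw [hsplit, h0, mul_zero, add_zero, ← antiV_mulVec_eq_cross, Finset.sum_comm]
  refine Finset.sum_congr rfl fun k _ => ?_
  conv_rhs => rw [← antiV_mul_tangProj, Matrix.mul_apply, Finset.sum_mul]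
  exact Finset.sum_congr rfl fun j _ => by simp only [grad]; ring

/-- `(1/2)·∇[anti(m·n)·T]:T = (1/2)·n × ∇⟨n,(sym m)·n⟩ + (1/2)·∇[anti(T·m·n)·T]:T`
at a point where `∇F ≠ 0`. -/
theorem statement1 (m : V3 → M3) (F : V3 → ℝ) (x₀ : V3)
    (hm : ∀ i j : Fin 3, ContDiff ℝ 1 fun x => m x i j)
    (hF : ContDiff ℝ 2 F) (hgrad : grad F x₀ ≠ 0) :
    ∀ i : Fin 3,
      (1 / 2 : ℝ) *
          ∑ j, ∑ k,
            pd (fun y => (antiV ((m y).mulVec (unitNormal F y)) * tangProj F y) i j) k x₀ *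
              tangProj F x₀ j k
        = (1 / 2 : ℝ) *
              cross (unitNormal F x₀)
                (grad (fun y => dot (unitNormal F y)
                  ((symPart (m y)).mulVec (unitNormal F y))) x₀) i
          + (1 / 2 : ℝ) *
              ∑ j, ∑ k,
                pd (fun y =>
                    (antiV ((tangProj F y).mulVec ((m y).mulVec (unitNormal F y))) *
                      tangProj F y) i j) k x₀ *
                  tangProj F x₀ j k := by
  intro i
  have hn := differentiableAt_unitNormal hF hgrad
  have hm' : ∀ a b, DifferentiableAt ℝ (fun y => m y a b) x₀ := fun a b =>
    (hm a b).differentiable (by norm_num) x₀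
  have hψ : DifferentiableAt ℝ (fun y => dot (unitNormal F y)
      ((symPart (m y)).mulVec (unitNormal F y))) x₀ := by
    simp only [dot, symPart, Matrix.mulVec, dotProduct, Matrix.smul_apply, Matrix.add_apply,
      Matrix.transpose_apply, smul_eq_mul]
    fun_prop
  have hK : ∀ j, DifferentiableAt ℝ (fun y =>
      (antiV ((tangProj F y).mulVec ((m y).mulVec (unitNormal F y))) * tangProj F y) i j) x₀ := by
    intro j
    simp only [antiV, tangProj, tensor, Matrix.mul_apply, Matrix.mulVec, dotProduct,
      Matrix.of_apply, Matrix.sub_apply]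
    fun_prop
  rw [← sum_pd_mul_antiV_unitNormal hF hgrad hψ i, ← mul_add, ← Finset.sum_add_distrib]
  congr 1
  refine Finset.sum_congr rfl fun j _ => ?_
  rw [← Finset.sum_add_distrib]
  refine Finset.sum_congr rfl fun k _ => ?_
  rw [← add_mul, ← pd_add (hψ.fun_mul (differentiableAt_antiV hn i j)) (hK j)]
  congr 2
  funext y
  rw [add_comm]
  exact antiV_mul_proj_split (m y) (unitNormal F y) i j
end
end

section
/- Let u : ℝ³ → ℝ³ be of class C², let α₁, α₂ ∈ ℝ and let n ∈ ℝ³. With the third-order hyperstress 𝔪_{ijk} = (α₁/2)(∂_k∂_j u_i − ∂_k∂_i u_j) + ((α₁−α₂)/4)(δ_{jk} ∂_i(div u) − δ_{jk} Δu_i + δ_{ik} Δu_j − δ_{ik} ∂_j(div u)) and Mindlin's couple stress tensor m̃ = ((α₁+α₂)/2)·∇curl u + ((α₁−α₂)/2)·(∇curl u)ᵀ, one has at every point of ℝ³ and for all i, j: Σ_k 𝔪_{ijk} n_k = −(1/2)·Σ_{p,q} ε_{ijp} m̃_{pq} n_q; equivalently, 𝔪·n = (1/2)·anti(m̃·n).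 -/
noncomputable section

open scoped BigOperators

/-- The third order hyperstress tensor of the indeterminate couple stress model:
`𝔪_{ijk} = (α₁/2)(∂_k∂_j u_i − ∂_k∂_i u_j)
  + ((α₁−α₂)/4)(δ_{jk} ∂_i(div u) − δ_{jk} Δu_i + δ_{ik} Δu_j − δ_{ik} ∂_j(div u))`. -/
def hyper (α₁ α₂ : ℝ) (u : V3 → V3) (i j k : Fin 3) (x : V3) : ℝ :=
  (α₁ / 2) * (pd2V u i j k x - pd2V u j i k x)
  + ((α₁ - α₂) / 4) *
      ((if j = k then (1 : ℝ) else 0) * pd (fun y => divV u y) i x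
        - (if j = k then (1 : ℝ) else 0) * lap (fun y => u y i) x
        + (if i = k then (1 : ℝ) else 0) * lap (fun y => u y j) x
        - (if i = k then (1 : ℝ) else 0) * pd (fun y => divV u y) j x)

/-- Mindlin's second order couple stress tensor:
`m̃_{il} = ((α₁+α₂)/2)·Σ_{j,k} ε_{ijk} ∂_l∂_j u_k + ((α₁−α₂)/2)·Σ_{j,k} ε_{ljk} ∂_i∂_j u_k`. -/
def mindlin (α₁ α₂ : ℝ) (u : V3 → V3) (i l : Fin 3) (x : V3) : ℝ :=
  ((α₁ + α₂) / 2) * ∑ j, ∑ k, eps i j k * pd2V u k j l x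
  + ((α₁ - α₂) / 2) * ∑ j, ∑ k, eps l j k * pd2V u k j i x

/-- Second partial derivatives of a `C²` vector field commute. -/
lemma pd2V_comm {u : V3 → V3} (hu : ContDiff ℝ 2 u) (i j k : Fin 3) (x : V3) :
    pd2V u i j k x = pd2V u i k j x := by
  have hf : ContDiff ℝ 2 (fun y => u y i) := contDiff_pi.1 hu i
  have hd : DifferentiableAt ℝ (fderiv ℝ fun y => u y i) x :=
    ((hf.fderiv_right (m := 1) (by norm_num)).differentiable (by norm_num)) x
  have hs : IsSymmSndFDerivAt ℝ (fun y => u y i) x :=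
    hf.contDiffAt.isSymmSndFDerivAt (by simp)
  have key : ∀ a b : Fin 3,
      pd2V u i a b x = fderiv ℝ (fderiv ℝ fun y => u y i) x (ee b) (ee a) := by
    intro a b
    simp only [pd2V, pdV, pd]
    rw [fderiv_clm_apply hd (differentiableAt_const _)]
    simp
  rw [key, key, hs.eq]

/-- The partial derivatives of a `C²` vector field are differentiable. -/
lemma differentiable_pdV {u : V3 → V3} (hu : ContDiff ℝ 2 u) (i k : Fin 3) :
    Differentiable ℝ (pdV u i k) := by
  have hf : ContDiff ℝ 2 (fun y => u y i) := contDiff_pi.1 hu i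
  exact ((hf.fderiv_right (m := 1) (by norm_num)).differentiable (by norm_num)).clm_apply
    (differentiable_const _)

/-- Derivative of the divergence in terms of second partial derivatives. -/
lemma pd_divV {u : V3 → V3} (hu : ContDiff ℝ 2 u) (i : Fin 3) (x : V3) :
    pd (fun y => divV u y) i x = ∑ p, pd2V u p p i x := by
  simp only [pd, divV, pd2V]
  rw [fderiv_fun_sum fun p _ => differentiable_pdV hu p p x]
  simp

/-- The Laplacian of a component in terms of second partial derivatives. -/
lemma lap_apply (u : V3 → V3) (i : Fin 3) (x : V3) :
    lap (fun y => u y i) x = ∑ m, pd2V u i m m x := rfl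

/-- `𝔪·n = (1/2)·anti(m̃·n)`, componentwise:
`Σ_k 𝔪_{ijk} n_k = −(1/2)·Σ_{p,q} ε_{ijp} m̃_{pq} n_q`. -/
theorem statement5 (α₁ α₂ : ℝ) (u : V3 → V3) (hu : ContDiff ℝ 2 u) (n : V3) :
    ∀ (i j : Fin 3) (x : V3),
      (∑ k, hyper α₁ α₂ u i j k x * n k)
        = -(1 / 2 : ℝ) * ∑ p, ∑ q, eps i j p * mindlin α₁ α₂ u p q x * n q := by
  intro i j x
  have h10 : ∀ i, pd2V u i 1 0 x = pd2V u i 0 1 x := fun i => pd2V_comm hu i 1 0 x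
  have h20 : ∀ i, pd2V u i 2 0 x = pd2V u i 0 2 x := fun i => pd2V_comm hu i 2 0 x
  have h21 : ∀ i, pd2V u i 2 1 x = pd2V u i 1 2 x := fun i => pd2V_comm hu i 2 1 x
  simp only [hyper, mindlin, pd_divV hu, lap_apply, Fin.sum_univ_three]
  fin_cases i <;> fin_cases j <;> simp [eps, h10, h20, h21, -mul_eq_zero] <;> ring
end
end

section
/- Let u : ℝ³ → ℝ³ be of class C² and let α₁, α₂ ∈ ℝ. Then at every point of ℝ³ the following three expressions for Mindlin's couple stress tensor coincide as matrices: ((α₁+α₂)/2)·∇curl u + ((α₁−α₂)/2)·(∇curl u)ᵀ = α₁·dev sym(∇curl u) + α₂·skw(∇curl u) = 2α₁·dev sym(∇[axl(skw ∇u)]) + 2α₂·skw(∇[axl(skw ∇u)]). -/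
noncomputable section

open scoped BigOperators

/-- `(∇curl u)_{il} = ∂_l (curl u)_i`. -/
def gradCurl (u : V3 → V3) (x : V3) : M3 := Matrix.of fun i l => pd (fun y => curl u y i) l x

/-- `(∇[axl(skw ∇u)])_{kl} = ∂_l (axl(skw ∇u))_k`. -/
def gradAxl (u : V3 → V3) (x : V3) : M3 :=
  Matrix.of fun k l => pd (fun y => axl (skwPart (gradV u y)) k) l x

lemma contDiff_pdV {u : V3 → V3} (hu : ContDiff ℝ 2 u) (i k : Fin 3) :
    ContDiff ℝ 1 (pdV u i k) := by
  have h : ContDiff ℝ 2 (fun y => u y i) := contDiff_pi.mp hu i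
  exact (h.fderiv_right (m := 1) (by norm_num)).clm_apply contDiff_const

lemma differentiableAt_pdV {u : V3 → V3} (hu : ContDiff ℝ 2 u) (i k : Fin 3) (x : V3) :
    DifferentiableAt ℝ (pdV u i k) x :=
  (contDiff_pdV hu i k).differentiable (by norm_num) x

lemma pd2V_eq_fderiv_fderiv {u : V3 → V3} (hu : ContDiff ℝ 2 u) (i j k : Fin 3) (x : V3) :
    pd2V u i j k x = fderiv ℝ (fderiv ℝ (fun y => u y i)) x (ee k) (ee j) := by
  have h : ContDiff ℝ 2 (fun y => u y i) := contDiff_pi.mp hu i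
  have hd : DifferentiableAt ℝ (fderiv ℝ (fun y => u y i)) x :=
    (h.fderiv_right (m := 1) (by norm_num)).differentiable (by norm_num) x
  simp only [pd2V, pdV, pd]
  rw [fderiv_clm_apply hd (differentiableAt_const _)]
  simp

lemma gradCurl_apply {u : V3 → V3} (hu : ContDiff ℝ 2 u) (x : V3) (i l : Fin 3) :
    gradCurl u x i l = ∑ j, ∑ k, eps i j k * pd2V u k j l x := by
  have hd := fun k j => differentiableAt_pdV hu k j x
  have h : HasFDerivAt (fun y => curl u y i)
      (∑ j, ∑ k, eps i j k • fderiv ℝ (pdV u k j) x) x :=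
    HasFDerivAt.fun_sum fun j _ => HasFDerivAt.fun_sum fun k _ =>
      (hd k j).hasFDerivAt.const_mul (eps i j k)
  simp only [gradCurl, Matrix.of_apply, pd, h.fderiv]
  simp [pd2V, pd]

/-- The identity `div curl u = 0`. -/
lemma trace_gradCurl {u : V3 → V3} (hu : ContDiff ℝ 2 u) (x : V3) :
    (gradCurl u x).trace = 0 := by
  simp only [Matrix.trace, Matrix.diag_apply, gradCurl_apply hu, Fin.sum_univ_three, eps]
  simp
  linarith [pd2V_comm hu 0 1 2 x, pd2V_comm hu 1 0 2 x, pd2V_comm hu 2 0 1 x]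

lemma axl_skwPart_gradV (u : V3 → V3) (x : V3) :
    axl (skwPart (gradV u x)) = (1 / 2 : ℝ) • curl u x := by
  ext k
  fin_cases k <;> simp [axl, skwPart, gradV, curl, eps, Fin.sum_univ_three] <;> ring

lemma gradAxl_eq (u : V3 → V3) (x : V3) : gradAxl u x = (1 / 2 : ℝ) • gradCurl u x := by
  ext k l
  simp only [gradAxl, gradCurl, axl_skwPart_gradV, pd, Matrix.of_apply, Matrix.smul_apply,
    Pi.smul_apply]
  change fderiv ℝ ((1 / 2 : ℝ) • fun y => curl u y k) x (ee l) = _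
  rw [fderiv_const_smul_field]
  simp

lemma symPart_smul (c : ℝ) (X : M3) : symPart (c • X) = c • symPart X := by
  simp only [symPart, Matrix.transpose_smul, ← smul_add, smul_comm c]

lemma skwPart_smul (c : ℝ) (X : M3) : skwPart (c • X) = c • skwPart X := by
  simp only [skwPart, Matrix.transpose_smul, ← smul_sub, smul_comm c]

lemma devPart_smul (c : ℝ) (X : M3) : devPart (c • X) = c • devPart X := by
  simp only [devPart, Matrix.trace_smul, smul_sub, smul_smul, smul_eq_mul, mul_div_assoc]

lemma devPart_symPart_of_trace_eq_zero {X : M3} (hX : X.trace = 0) :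
    devPart (symPart X) = symPart X := by
  simp [devPart, symPart, hX]

/-- The three equivalent forms of Mindlin's couple stress tensor. -/
theorem statement12 (α₁ α₂ : ℝ) (u : V3 → V3) (hu : ContDiff ℝ 2 u) (x : V3) :
    ((α₁ + α₂) / 2) • gradCurl u x + ((α₁ - α₂) / 2) • (gradCurl u x).transpose
        = α₁ • devPart (symPart (gradCurl u x)) + α₂ • skwPart (gradCurl u x) ∧
      α₁ • devPart (symPart (gradCurl u x)) + α₂ • skwPart (gradCurl u x)
        = (2 * α₁) • devPart (symPart (gradAxl u x)) + (2 * α₂) • skwPart (gradAxl u x) := by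
  refine ⟨?_, ?_⟩
  · rw [devPart_symPart_of_trace_eq_zero (trace_gradCurl hu x)]
    simp only [symPart, skwPart]
    module
  · rw [gradAxl_eq, symPart_smul, skwPart_smul, devPart_smul]
    module
end
end

section
/- Let u : ℝ³ → ℝ³ be of class C², let α₁, α₂ ∈ ℝ and let n ∈ ℝ³ be a unit vector. With the third-order hyperstress 𝔪_{ijk} = (α₁/2)(∂_k∂_j u_i − ∂_k∂_i u_j) + ((α₁−α₂)/4)(δ_{jk} ∂_i(div u) − δ_{jk} Δu_i + δ_{ik} Δu_j − δ_{ik} ∂_j(div u)), one has at every point of ℝ³: Σ_{i,j,k} 𝔪_{ijk} n_i n_j n_k = 0, i.e. the normal component ⟨(𝔪·n)·n, n⟩ of the double-force traction vanishes. (Hence only the two tangential components of the normal derivative of the displacement can be worked against at the boundary.) -/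
noncomputable section

open scoped BigOperators

theorem hyper_swap (α₁ α₂ : ℝ) (u : V3 → V3) (i j k : Fin 3) (x : V3) :
    hyper α₁ α₂ u j i k x = -hyper α₁ α₂ u i j k x := by
  simp only [hyper]
  ring

/-- The normal component `⟨(𝔪·n)·n, n⟩ = Σ_{i,j,k} 𝔪_{ijk} n_i n_j n_k` of the double-force
traction vanishes. -/
theorem statement16 (α₁ α₂ : ℝ) (u : V3 → V3) (hu : ContDiff ℝ 2 u)
    (n : V3) (hn : dot n n = 1) (x : V3) :
    ∑ i, ∑ j, ∑ k, hyper α₁ α₂ u i j k x * n i * n j * n k = 0 := by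
  rw [← self_eq_neg]
  conv_lhs => rw [Finset.sum_comm]
  simp only [← Finset.sum_neg_distrib]
  refine Finset.sum_congr rfl fun i _ => Finset.sum_congr rfl fun j _ =>
    Finset.sum_congr rfl fun k _ => ?_
  rw [hyper_swap]
  ring
end
end
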